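/- For every n ≥ 0, the variety V_n of normal modal algebras validating K4C_n satisfies V_n = HSP(C_n^+) = SP_U(C_n^+), where C_n^+ is the class of complex (powerset) algebras of finite transitive frames of circumference at most n. In particular every algebra in V_n embeds into an ultraproduct of such finite algebras. -/

import Mathlib

/-- Modal formulas: variables, ⊤, ¬, ∧, □. -/
inductive Fml : Type
  | var : ℕ → Fml
  | top : Fml
  | neg : Fml → Fml
  | and : Fml → Fml → Fml
  | box : Fml → Fml
deriving DecidableEq

namespace Fml
/-- Material implication, defined from ¬ and ∧. -/
def imp (φ ψ : Fml) : Fml := .neg (.and φ (.neg ψ))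
/-- Disjunction. -/
def or (φ ψ : Fml) : Fml := .neg (.and (.neg φ) (.neg ψ))
/-- ◇φ := ¬□¬φ. -/
def dia (φ : Fml) : Fml := .neg (.box (.neg φ))
/-- □*φ := φ ∧ □φ. -/
def boxs (φ : Fml) : Fml := .and φ (.box φ)
/-- ◇*φ := φ ∨ ◇φ. -/
def dias (φ : Fml) : Fml := Fml.or φ (dia φ)
end Fml

/-- Kripke satisfaction. -/
def sat {W : Type} (R : W → W → Prop) (V : ℕ → Set W) : W → Fml → Prop
  | x, .var p => x ∈ V p
  | _, .top => True
  | x, .neg φ => ¬ sat R V x φ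
  | x, .and φ ψ => sat R V x φ ∧ sat R V x ψ
  | x, .box φ => ∀ y, R x y → sat R V y φ

/-- P_n(φ0; φ1,...,φn): P_0(φ0) = ◇φ0, P_n(φ0,φ1,...,φn) = ◇(φ1 ∧ P_{n-1}(φ0,φ2,...,φn)). -/
def Pfml (φ0 : Fml) : List Fml → Fml
  | [] => φ0.dia
  | ψ :: rest => (Fml.and ψ (Pfml φ0 rest)).dia

/-- Conjunction of ¬(φ ∧ ψ) for ψ in the list. -/
def conjNeg (φ : Fml) : List Fml → Fml
  | [] => .top
  | ψ :: rest => .and (.neg (.and φ ψ)) (conjNeg φ rest)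

/-- D_n: pairwise disjointness conjunction ⋀_{i<j} ¬(φ_i ∧ φ_j). -/
def Dfml : List Fml → Fml
  | [] => .top
  | φ :: rest => .and (conjNeg φ rest) (Dfml rest)

/-- The scheme C_n instance on φ0,φ1,...,φn (φs = [φ1,...,φn]). -/
def Cfml (φ0 : Fml) (φs : List Fml) : Fml :=
  ((Dfml (φ0 :: φs)).boxs).imp ((φ0.dia).imp ((Fml.and φ0 (Fml.neg (Pfml φ0 φs))).dia))

/-- The scheme C_n* instance: as C_n but with ◇* in the consequent. -/
def CfmlStar (φ0 : Fml) (φs : List Fml) : Fml :=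
  ((Dfml (φ0 :: φs)).boxs).imp ((φ0.dia).imp ((Fml.and φ0 (Fml.neg (Pfml φ0 φs))).dias))

/-- An ascending R-chain. -/
def AscChain {W : Type} (R : W → W → Prop) (x : ℕ → W) : Prop := ∀ m, R (x m) (x (m+1))

/-- A strictly ascending R-chain. -/
def StrictAscChain {W : Type} (R : W → W → Prop) (x : ℕ → W) : Prop :=
  AscChain R x ∧ ∀ m, ¬ R (x (m+1)) (x m)

/-- The R-cluster of x. -/
def cluster {W : Type} (R : W → W → Prop) (x : W) : Set W := {y | x = y ∨ (R x y ∧ R y x)}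

/-- The frame has a cycle of length k (k ≥ 1): k distinct points x_0 R x_1 R ... R x_{k-1} R x_0. -/
def HasCycle {W : Type} (R : W → W → Prop) (k : ℕ) : Prop :=
  1 ≤ k ∧ ∃ x : ℕ → W, (∀ i j, i < k → j < k → x i = x j → i = j) ∧
    ∀ i < k, R (x i) (x ((i+1) % k))

/-- Circumference at most n: every cycle has length ≤ n. -/
def CircumLE {W : Type} (R : W → W → Prop) (n : ℕ) : Prop := ∀ k, HasCycle R k → k ≤ n

/-- The frame (W,R) validates the scheme C_n. -/
def ValidatesCn {W : Type} (R : W → W → Prop) (n : ℕ) : Prop :=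
  ∀ (V : ℕ → Set W) (x : W) (φ0 : Fml) (φs : List Fml), φs.length = n →
    sat R V x (Cfml φ0 φs)

/-- A Boolean valuation on formulas (box-formulas and variables as atoms). -/
def BoolEval (w : Fml → Bool) : Prop :=
  w .top = true ∧ (∀ φ, w (.neg φ) = !w φ) ∧ (∀ φ ψ, w (.and φ ψ) = (w φ && w ψ))

/-- Propositional tautologies. -/
def Tautology (φ : Fml) : Prop := ∀ w, BoolEval w → w φ = true

/-- Theorems of the smallest normal modal logic containing the axiom set Ax. -/
inductive Prov (Ax : Set Fml) : Fml → Prop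
  | taut {φ} : Tautology φ → Prov Ax φ
  | kax (φ ψ) : Prov Ax ((Fml.box (φ.imp ψ)).imp ((Fml.box φ).imp (Fml.box ψ)))
  | ax {φ} : φ ∈ Ax → Prov Ax φ
  | mp {φ ψ} : Prov Ax (φ.imp ψ) → Prov Ax φ → Prov Ax ψ
  | nec {φ} : Prov Ax φ → Prov Ax (.box φ)

/-- All instances of the transitivity scheme 4. -/
def Ax4 : Set Fml := {χ | ∃ φ, χ = (Fml.box φ).imp (Fml.box (Fml.box φ))}

/-- Axioms of K4C_n: scheme 4 together with all instances of scheme C_n. -/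
def AxK4C (n : ℕ) : Set Fml :=
  Ax4 ∪ {χ | ∃ (φ0 : Fml) (φs : List Fml), φs.length = n ∧ χ = Cfml φ0 φs}

/-- A bundled Boolean algebra with a unary operation (a modal algebra candidate). -/
structure MAlg : Type 1 where
  α : Type
  [ba : BooleanAlgebra α]
  f : α → α

attribute [instance] MAlg.ba

/-- Evaluation of a modal formula as a term function of a modal algebra. -/
def aeval {A : Type} [BooleanAlgebra A] (f : A → A) (v : ℕ → A) : Fml → A
  | .var p => v p
  | .top => ⊤
  | .neg φ => (aeval f v φ)ᶜ
  | .and φ ψ => aeval f v φ ⊓ aeval f v ψ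
  | .box φ => f (aeval f v φ)

/-- Validity of a formula in an algebra: its term function is constantly ⊤. -/
def MAlg.valid (A : MAlg) (φ : Fml) : Prop := ∀ v : ℕ → A.α, aeval A.f v φ = ⊤

/-- Normality: f preserves finite meets. -/
def MAlg.normal (A : MAlg) : Prop := A.f ⊤ = ⊤ ∧ ∀ a b : A.α, A.f (a ⊓ b) = A.f a ⊓ A.f b

/-- The variety V_n: normal modal algebras validating all theorems of K4C_n. -/
def Vn (n : ℕ) : Set MAlg := {A | A.normal ∧ ∀ φ, Prov (AxK4C n) φ → A.valid φ}

/-- Homomorphisms of modal algebras. -/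
def MHom (A B : MAlg) (h : A.α → B.α) : Prop :=
  (∀ a b, h (a ⊓ b) = h a ⊓ h b) ∧ (∀ a, h aᶜ = (h a)ᶜ) ∧ h ⊤ = ⊤ ∧
    ∀ a, h (A.f a) = B.f (h a)

/-- Homomorphic images. -/
def Hcl (K : Set MAlg) : Set MAlg :=
  {B | ∃ A ∈ K, ∃ h : A.α → B.α, MHom A B h ∧ Function.Surjective h}

/-- Isomorphic copies of subalgebras. -/
def Scl (K : Set MAlg) : Set MAlg :=
  {B | ∃ A ∈ K, ∃ h : B.α → A.α, MHom B A h ∧ Function.Injective h}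

/-- The product algebra of a family. -/
def prodAlg {I : Type} (A : I → MAlg) : MAlg :=
  { α := ∀ i, (A i).α, f := fun g i => (A i).f (g i) }

/-- Isomorphic copies of direct products. -/
def Pcl (K : Set MAlg) : Set MAlg :=
  {B | ∃ (I : Type) (A : I → MAlg), (∀ i, A i ∈ K) ∧
    ∃ h : B.α → (prodAlg A).α, MHom B (prodAlg A) h ∧ Function.Bijective h}

/-- Isomorphic copies of subalgebras of ultraproducts: B embeds into the
ultraproduct of the family A over the ultrafilter U, rendered as a map into the
direct product that is injective and a homomorphism modulo U. -/
def SPuCl (K : Set MAlg) : Set MAlg :=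
  {B | ∃ (I : Type) (U : Ultrafilter I) (A : I → MAlg), (∀ i, A i ∈ K) ∧
    ∃ e : B.α → ∀ i, (A i).α,
      (∀ a b : B.α, {i | e a i = e b i} ∈ U → a = b) ∧
      (∀ a b : B.α, {i | e (a ⊓ b) i = e a i ⊓ e b i} ∈ U) ∧
      (∀ a : B.α, {i | e aᶜ i = (e a i)ᶜ} ∈ U) ∧
      ({i | e ⊤ i = ⊤} ∈ U) ∧
      (∀ a : B.α, {i | e (B.f a) i = (A i).f (e a i)} ∈ U)}

/-- The complex (powerset) algebra of a frame, with [R] as the operation. -/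
def cplx (W : Type) (R : W → W → Prop) : MAlg :=
  { α := Set W, f := fun Y => {x | ∀ y, R x y → y ∈ Y} }

/-- The class 𝒞_n⁺ of complex algebras of finite transitive frames of
circumference at most n. -/
def CnPlus (n : ℕ) : Set MAlg :=
  {A | ∃ (W : Type) (R : W → W → Prop), Finite W ∧ Transitive R ∧ CircumLE R n ∧
    A = cplx W R}

/-- The points of the canonical frame of a Boolean algebra, given as ultrafilters. -/
structure StonePt (A : Type) [BooleanAlgebra A] where
  carrier : Set A
  top_mem : ⊤ ∈ carrier
  inf_mem_iff : ∀ a b, a ⊓ b ∈ carrier ↔ a ∈ carrier ∧ b ∈ carrier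
  compl_mem_iff : ∀ a, aᶜ ∈ carrier ↔ a ∉ carrier

namespace StonePt

section Basic

variable {A : Type} [BooleanAlgebra A]

instance : Membership A (StonePt A) := ⟨fun x a => a ∈ x.carrier⟩

lemma mem_top (x : StonePt A) : ⊤ ∈ x := x.top_mem

lemma mem_inf (x : StonePt A) {a b : A} : a ⊓ b ∈ x ↔ a ∈ x ∧ b ∈ x := x.inf_mem_iff a b

lemma mem_compl (x : StonePt A) {a : A} : aᶜ ∈ x ↔ a ∉ x := x.compl_mem_iff a

lemma mem_of_le (x : StonePt A) {a b : A} (h : a ≤ b) (ha : a ∈ x) : b ∈ x := by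
  rw [← inf_eq_left.2 h, mem_inf] at ha
  exact ha.2

/-- Separation of a filter from an element outside it. -/
lemma exists_of_notMem_filter {F : Set A} (htop : ⊤ ∈ F)
    (hinf : ∀ a b, a ⊓ b ∈ F ↔ a ∈ F ∧ b ∈ F) {c : A} (hc : c ∉ F) :
    ∃ x : StonePt A, (∀ a ∈ F, a ∈ x) ∧ c ∉ x := by
  have hup : ∀ {a b : A}, a ≤ b → a ∈ F → b ∈ F := fun {a b} h ha => by
    rw [← inf_eq_left.2 h, hinf] at ha
    exact ha.2
  have hF : Order.IsPFilter F := Order.IsPFilter.of_def ⟨⊤, htop⟩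
    (fun a ha b hb => ⟨a ⊓ b, (hinf a b).2 ⟨ha, hb⟩, inf_le_left, inf_le_right⟩) hup
  have hdisj : Disjoint (hF.toPFilter : Set A) (Order.Ideal.principal c : Set A) :=
    Set.disjoint_left.2 fun a (ha : a ∈ F) (hac : a ≤ c) => hc (hup hac ha)
  obtain ⟨J, hJ, hIJ, hFJ⟩ := DistribLattice.prime_ideal_of_disjoint_filter_ideal hdisj
  have htopJ : ⊤ ∉ J := fun h => Set.disjoint_left.1 hFJ (show ⊤ ∈ F from htop) h
  refine ⟨⟨(J : Set A)ᶜ, htopJ, fun a b => ?_, fun a => ?_⟩, fun a ha h => ?_, fun h => ?_⟩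
  · refine ⟨fun h => ⟨fun ha => h (J.lower inf_le_left ha), fun hb => h (J.lower inf_le_right hb)⟩,
      fun h hab => ?_⟩
    exact (hJ.mem_or_mem hab).elim h.1 h.2
  · refine ⟨fun h ha => ?_, fun ha hac => ?_⟩
    · exact (hJ.mem_or_compl_mem (x := a)).elim ha h
    · refine ha fun h => htopJ ?_
      rw [← sup_compl_eq_top (x := a)]
      exact Order.Ideal.sup_mem h hac
  · exact Set.disjoint_left.1 hFJ (show a ∈ F from ha) h
  · exact h (hIJ (Order.Ideal.mem_principal_self))

lemma exists_mem_notMem {a b : A} (h : ¬ a ≤ b) : ∃ x : StonePt A, a ∈ x ∧ b ∉ x := by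
  obtain ⟨x, hx, hb⟩ := exists_of_notMem_filter (F := {c | a ≤ c}) le_top
    (fun _ _ => le_inf_iff) (c := b) h
  exact ⟨x, hx a le_rfl, hb⟩

lemma eq_of_forall_mem_iff {a b : A} (h : ∀ x : StonePt A, a ∈ x ↔ b ∈ x) : a = b := by
  refine le_antisymm ?_ ?_ <;> by_contra hle <;> obtain ⟨x, h1, h2⟩ := exists_mem_notMem hle
  · exact h2 ((h x).1 h1)
  · exact h2 ((h x).2 h1)

/-- The clopen set of all points agreeing with a given set on finitely many elements. -/
lemma exists_characteristic {G : Set A} (hG : G.Finite) (t : Set A) :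
    ∃ c : A, ∀ x : StonePt A, c ∈ x ↔ ∀ a ∈ G, (a ∈ x ↔ a ∈ t) := by
  induction G, hG using Set.Finite.induction_on with
  | empty => exact ⟨⊤, fun x => by simp [mem_top]⟩
  | @insert b s _ _ ih =>
    obtain ⟨c, hc⟩ := ih
    by_cases hb : b ∈ t
    · exact ⟨b ⊓ c, fun x => by simp [mem_inf, hc, hb]⟩
    · exact ⟨bᶜ ⊓ c, fun x => by simp [mem_inf, mem_compl, hc, hb]⟩

end Basic

variable {A : MAlg}

/-- The canonical accessibility relation. -/
def Rel (A : MAlg) (x y : StonePt A.α) : Prop := ∀ a, A.f a ∈ x → a ∈ y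

lemma forall_rel_mem_iff (hA : A.normal) (x : StonePt A.α) (a : A.α) :
    A.f a ∈ x ↔ ∀ y, Rel A x y → a ∈ y := by
  refine ⟨fun h y hxy => hxy a h, fun h => ?_⟩
  by_contra ha
  obtain ⟨y, hxy, hy⟩ := exists_of_notMem_filter (F := {b | A.f b ∈ x})
    (by simpa [hA.1] using x.mem_top)
    (fun b c => by simp only [Set.mem_ofPred_eq, hA.2, mem_inf]) (c := a) ha
  exact hy (h y hxy)

lemma mem_aeval_iff (hA : A.normal) (v : ℕ → A.α) (x : StonePt A.α) (φ : Fml) :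
    aeval A.f v φ ∈ x ↔ sat (Rel A) (fun i => {y | v i ∈ y}) x φ := by
  induction φ generalizing x with
  | var p => rfl
  | top => simp [aeval, sat, mem_top]
  | neg φ ih => simp [aeval, sat, mem_compl, ih]
  | and φ ψ ih1 ih2 => simp [aeval, sat, mem_inf, ih1, ih2]
  | box φ ih => simp [aeval, sat, forall_rel_mem_iff hA, ih]

lemma sat_of_mem_Vn {n : ℕ} (hA : A ∈ Vn n) {φ : Fml} (hφ : Prov (AxK4C n) φ) (v : ℕ → A.α)
    (x : StonePt A.α) : sat (Rel A) (fun i => {y | v i ∈ y}) x φ := by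
  rw [← mem_aeval_iff hA.1, hA.2 φ hφ v]
  exact x.mem_top

lemma f_le_f_f {n : ℕ} (hA : A ∈ Vn n) (x : StonePt A.α) {a : A.α} (h : A.f a ∈ x) :
    A.f (A.f a) ∈ x := by
  have := sat_of_mem_Vn hA (Prov.ax (Or.inl ⟨Fml.var 0, rfl⟩)) (fun _ => a) x
  rw [← mem_aeval_iff hA.1] at this
  simp only [Fml.imp, aeval, mem_compl, mem_inf] at this
  tauto

lemma rel_transitive {n : ℕ} (hA : A ∈ Vn n) : Transitive (Rel A) :=
  fun x _ _ hxy hyz a ha => hyz a (hxy _ (f_le_f_f hA x ha))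

end StonePt

section Semantics

variable {W : Type} {R : W → W → Prop} {V : ℕ → Set W}

lemma sat_imp {x : W} {φ ψ : Fml} : sat R V x (φ.imp ψ) ↔ (sat R V x φ → sat R V x ψ) := by
  simp [Fml.imp, sat]

lemma sat_dia {x : W} {φ : Fml} : sat R V x φ.dia ↔ ∃ y, R x y ∧ sat R V y φ := by
  simp [Fml.dia, sat]

lemma sat_conjNeg {x : W} {φ : Fml} {l : List Fml} :
    sat R V x (conjNeg φ l) ↔ ∀ ψ ∈ l, ¬ (sat R V x φ ∧ sat R V x ψ) := by
  induction l with
  | nil => simp [conjNeg, sat]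
  | cons ψ l ih => simp [conjNeg, sat, ih]

lemma sat_Dfml {x : W} {l : List Fml} :
    sat R V x (Dfml l) ↔ l.Pairwise fun φ ψ => ¬ (sat R V x φ ∧ sat R V x ψ) := by
  induction l with
  | nil => simp [Dfml, sat]
  | cons ψ l ih => rw [List.pairwise_cons, ← ih, ← sat_conjNeg]; rfl

lemma sat_Cfml {x : W} {φ : Fml} {l : List Fml} :
    sat R V x (Cfml φ l) ↔ (sat R V x (Dfml (φ :: l)) ∧ ∀ y, R x y → sat R V y (Dfml (φ :: l))) →
      (∃ y, R x y ∧ sat R V y φ) → ∃ y, R x y ∧ sat R V y φ ∧ ¬ sat R V y (Pfml φ l) := by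
  rw [Cfml, sat_imp, sat_imp, sat_dia, sat_dia]
  rfl

/-- A point satisfying `Pfml φ l` starts a path through the formulas of `l` ending in `φ`. -/
lemma exists_path_of_sat_Pfml {x : W} {φ : Fml} {l : List Fml} (h : sat R V x (Pfml φ l)) :
    ∃ y : ℕ → W, y 0 = x ∧
      (∀ i (hi : i < l.length), R (y i) (y (i + 1)) ∧ sat R V (y (i + 1)) l[i]) ∧
      ∃ z, R (y l.length) z ∧ sat R V z φ := by
  induction l generalizing x with
  | nil => exact ⟨fun _ => x, rfl, by simp, sat_dia.1 h⟩
  | cons ψ l ih =>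
    obtain ⟨u, hxu, hψ, hu⟩ := sat_dia.1 h
    obtain ⟨y, rfl, hy, z, hz, hφ⟩ := ih hu
    refine ⟨fun i => i.casesOn x y, rfl, ?_, z, hz, hφ⟩
    rintro (_ | i) hi
    · exact ⟨hxu, hψ⟩
    · exact hy i (by simpa using hi)

lemma Transitive.rel_of_lt (hR : Transitive R) {y : ℕ → W} {m : ℕ}
    (h : ∀ i < m, R (y i) (y (i + 1))) {i j : ℕ} (hij : i < j) (hj : j ≤ m) : R (y i) (y j) := by
  induction j, hij using Nat.le_induction with
  | base => exact h i hj
  | succ j hij ih => exact hR (ih (by omega)) (h j hj)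

lemma Transitive.rel_of_cycle (hR : Transitive R) {y : ℕ → W} {k : ℕ}
    (h : ∀ i < k, R (y i) (y ((i + 1) % k))) {i j : ℕ} (hi : i < k) (hj : j < k) :
    R (y i) (y j) := by
  have hp := hR.rel_of_lt (y := fun i => y (i % k)) (m := k + j) (i := i) (j := k + j)
    (fun i _ => by simpa using h (i % k) (Nat.mod_lt _ (by omega))) (by omega) le_rfl
  simpa [Nat.mod_eq_of_lt hi, Nat.mod_eq_of_lt hj] using hp

lemma exists_maximal_of_transitive [Finite W] (hR : Transitive R) {T : Set W} (hT : T.Nonempty) :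
    ∃ y ∈ T, ∀ z ∈ T, R y z → R z y := by
  let r : W → W → Prop := fun a b => R b a ∧ ¬ R a b
  have : IsTrans W r := ⟨fun a b c hab hbc =>
    ⟨hR hbc.1 hab.1, fun hac => hab.2 (hR hac hbc.1)⟩⟩
  have : Std.Irrefl r := ⟨fun a h => h.2 h.1⟩
  obtain ⟨y, hy, hmin⟩ := (Finite.wellFounded_of_trans_of_irrefl r).has_min T hT
  exact ⟨y, hy, fun z hz hyz => by_contra fun h => hmin z hz ⟨hyz, h⟩⟩

lemma CircumLE.sat_Cfml [Finite W] {n : ℕ} (hR : Transitive R) (hn : CircumLE R n) {x : W}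
    {φ : Fml} {l : List Fml} (hl : l.length = n) : sat R V x (Cfml φ l) := by
  refine _root_.sat_Cfml.2 fun ⟨_, hD⟩ hT => ?_
  obtain ⟨y₀, ⟨hxy, hφ⟩, hmax⟩ := exists_maximal_of_transitive hR
    (T := {y | R x y ∧ sat R V y φ}) hT
  refine ⟨y₀, hxy, hφ, fun hP => ?_⟩
  obtain ⟨y, rfl, hy, z, hz, hzφ⟩ := exists_path_of_sat_Pfml hP
  subst hl
  have hlt := fun i j => hR.rel_of_lt (fun i hi => (hy i hi).1) (i := i) (j := j)
  have hx : ∀ i ≤ l.length, R x (y i) := fun i hi => by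
    rcases Nat.eq_zero_or_pos i with rfl | h
    · exact hxy
    · exact hR hxy (hlt 0 i h hi)
  have h0z : R (y 0) z := by
    rcases Nat.eq_zero_or_pos l.length with h | h
    · rwa [h] at hz
    · exact hR (hlt 0 _ h le_rfl) hz
  have hback : R (y l.length) (y 0) := hR hz (hmax z ⟨hR hxy h0z, hzφ⟩ h0z)
  have hsat : ∀ i (hi : i < (φ :: l).length), sat R V (y i) (φ :: l)[i] := by
    rintro (_ | i) hi
    · exact hφ
    · exact (hy i (by simpa using hi)).2
  have hne : ∀ i j, i < j → j ≤ l.length → y i ≠ y j := fun i j hij hj heq => by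
    have hD' := List.pairwise_iff_getElem.1 (sat_Dfml.1 (hD (y i) (hx i (by omega))))
    refine hD' i j (by simp; omega) (by simp; omega) hij ⟨hsat i _, ?_⟩
    rw [heq]
    exact hsat j _
  have := hn (l.length + 1) ⟨by omega, y, fun i j hi hj heq => ?_, fun i hi => ?_⟩
  · omega
  · rcases lt_trichotomy i j with h | h | h
    · exact (hne i j h (by omega) heq).elim
    · exact h
    · exact (hne j i h (by omega) heq.symm).elim
  · rcases Nat.lt_or_ge i l.length with h | h
    · rw [Nat.mod_eq_of_lt (by omega)]
      exact (hy i h).1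
    · obtain rfl : i = l.length := by omega
      simpa using hback

lemma sat_of_prov [Finite W] {n : ℕ} (hR : Transitive R) (hn : CircumLE R n) {φ : Fml}
    (h : Prov (AxK4C n) φ) (x : W) : sat R V x φ := by
  classical
  induction h generalizing x with
  | taut ht =>
    obtain ⟨w, hw⟩ : ∃ w : Fml → Bool, ∀ ψ, w ψ = true ↔ sat R V x ψ :=
      ⟨fun ψ => decide (sat R V x ψ), fun ψ => decide_eq_true_iff⟩
    refine (hw _).1 (ht w ⟨(hw _).2 trivial, fun ψ => ?_, fun ψ χ => ?_⟩) <;>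
      rw [Bool.eq_iff_iff, hw]
    · rw [Bool.not_eq_eq_eq_not, Bool.not_true, ← Bool.not_eq_true, hw]
      rfl
    · rw [Bool.and_eq_true, hw, hw]
      rfl
  | kax φ ψ =>
    simp only [sat_imp]
    intro h1 h2 y hy
    exact sat_imp.1 (h1 y hy) (h2 y hy)
  | ax h =>
    rcases h with ⟨φ, rfl⟩ | ⟨φ, l, hl, rfl⟩
    · exact sat_imp.2 fun h y hy z hz => h z (hR hy hz)
    · exact hn.sat_Cfml hR hl
  | mp _ _ ih1 ih2 => exact sat_imp.1 (ih1 x) (ih2 x)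
  | nec _ ih => exact fun y _ => ih y

lemma aeval_cplx (v : ℕ → Set W) (φ : Fml) :
    aeval (cplx W R).f v φ = {x | sat R v x φ} := by
  induction φ with
  | var p => rfl
  | top => rfl
  | neg φ ih => simp only [aeval]; rw [ih]; rfl
  | and φ ψ ih1 ih2 => simp only [aeval]; rw [ih1, ih2]; rfl
  | box φ ih => simp only [aeval]; rw [ih]; rfl

lemma cplx_normal (W : Type) (R : W → W → Prop) : (cplx W R).normal := by
  refine ⟨Set.eq_univ_of_forall fun x y _ => trivial, fun a b => Set.ext fun x => ?_⟩
  exact ⟨fun h => ⟨fun y hy => (h y hy).1, fun y hy => (h y hy).2⟩,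
    fun h y hy => ⟨h.1 y hy, h.2 y hy⟩⟩

end Semantics

lemma CnPlus_subset_Vn (n : ℕ) : CnPlus n ⊆ Vn n := by
  rintro _ ⟨W, R, hW, hR, hn, rfl⟩
  refine ⟨cplx_normal W R, fun φ hφ v => ?_⟩
  exact (aeval_cplx v φ).trans (Set.eq_univ_of_forall fun x => sat_of_prov hR hn hφ x)

lemma MHom.map_aeval {A B : MAlg} {h : A.α → B.α} (hh : MHom A B h) (v : ℕ → A.α) (φ : Fml) :
    h (aeval A.f v φ) = aeval B.f (h ∘ v) φ := by
  obtain ⟨h1, h2, h3, h4⟩ := hh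
  induction φ with
  | var p => rfl
  | top => exact h3
  | neg φ ih => simp only [aeval, h2, ih]
  | and φ ψ ih1 ih2 => simp only [aeval, h1, ih1, ih2]
  | box φ ih => simp only [aeval, h4, ih]

lemma Hcl_subset_Vn {n : ℕ} {K : Set MAlg} (hK : K ⊆ Vn n) : Hcl K ⊆ Vn n := by
  rintro B ⟨A, hA, h, hh, hs⟩
  obtain ⟨hn, hv⟩ := hK hA
  refine ⟨⟨?_, fun a b => ?_⟩, fun φ hφ v => ?_⟩
  · rw [← hh.2.2.1, ← hh.2.2.2, hn.1]
  · obtain ⟨a, rfl⟩ := hs a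
    obtain ⟨b, rfl⟩ := hs b
    rw [← hh.1, ← hh.2.2.2, hn.2, hh.1, hh.2.2.2, hh.2.2.2]
  · obtain ⟨u, rfl⟩ : ∃ u, h ∘ u = v :=
      ⟨fun i => (hs (v i)).choose, funext fun i => (hs (v i)).choose_spec⟩
    rw [← hh.map_aeval, hv φ hφ, hh.2.2.1]

lemma Scl_subset_Vn {n : ℕ} {K : Set MAlg} (hK : K ⊆ Vn n) : Scl K ⊆ Vn n := by
  rintro B ⟨A, hA, h, hh, hi⟩
  obtain ⟨hn, hv⟩ := hK hA
  refine ⟨⟨hi ?_, fun a b => hi ?_⟩, fun φ hφ v => hi ?_⟩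
  · rw [hh.2.2.2, hh.2.2.1, hn.1]
  · rw [hh.1, hh.2.2.2, hh.2.2.2, hh.1, hh.2.2.2, hn.2]
  · rw [hh.map_aeval, hv φ hφ, hh.2.2.1]

lemma Pcl_subset_Vn {n : ℕ} {K : Set MAlg} (hK : K ⊆ Vn n) : Pcl K ⊆ Vn n := by
  rintro B ⟨I, A, hA, h, hh, hb⟩
  refine Scl_subset_Vn (K := {prodAlg A}) ?_ ⟨prodAlg A, rfl, h, hh, hb.1⟩
  rintro _ rfl
  refine ⟨⟨funext fun i => (hK (hA i)).1.1, fun a b => funext fun i => (hK (hA i)).1.2 _ _⟩,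
    fun φ hφ v => funext fun i => ?_⟩
  have hproj : MHom (prodAlg A) (A i) (fun g => g i) :=
    ⟨fun _ _ => rfl, fun _ => rfl, rfl, fun _ => rfl⟩
  exact (hproj.map_aeval v φ).trans ((hK (hA i)).2 φ hφ _)

lemma SPuCl_subset_HSP (K : Set MAlg) : SPuCl K ⊆ Hcl (Scl (Pcl K)) := by
  rintro B ⟨I, U, A, hA, e, hinj, hinf, hcompl, htop, hf⟩
  let r : B.α → (prodAlg A).α → Prop := fun b g => {i | e b i = g i} ∈ U
  have r_inf : ∀ {a b g k}, r a g → r b k → r (a ⊓ b) (g ⊓ k) := fun {a b g k} h1 h2 => by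
    filter_upwards [h1, h2, hinf a b] with i (h1 : e a i = g i) (h2 : e b i = k i)
      (h3 : e (a ⊓ b) i = _)
    exact (h3.trans (by rw [h1, h2]) : e (a ⊓ b) i = g i ⊓ k i)
  have r_compl : ∀ {a g}, r a g → r aᶜ gᶜ := fun {a g} h1 => by
    filter_upwards [h1, hcompl a] with i (h1 : e a i = g i) (h3 : e aᶜ i = _)
    exact (h3.trans (by rw [h1]) : e aᶜ i = (g i)ᶜ)
  have r_f : ∀ {a g}, r a g → r (B.f a) ((prodAlg A).f g) := fun {a g} h1 => by
    filter_upwards [h1, hf a] with i (h1 : e a i = g i) (h3 : e (B.f a) i = _)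
    exact (h3.trans (by rw [h1]) : e (B.f a) i = (A i).f (g i))
  have r_top : r ⊤ ⊤ := htop
  have r_unique : ∀ {a b g}, r a g → r b g → a = b := fun {a b g} h1 h2 => by
    refine hinj a b ?_
    filter_upwards [h1, h2] with i h1 h2
    exact h1.trans h2.symm
  let L : BooleanSubalgebra (prodAlg A).α :=
    { carrier := {g | ∃ b, r b g}
      supClosed' := by
        rintro g ⟨a, ha⟩ k ⟨b, hb⟩
        refine ⟨(aᶜ ⊓ bᶜ)ᶜ, ?_⟩
        simpa [compl_inf] using r_compl (r_inf (r_compl ha) (r_compl hb))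
      infClosed' := by
        rintro g ⟨a, ha⟩ k ⟨b, hb⟩
        exact ⟨a ⊓ b, r_inf ha hb⟩
      compl_mem' := by
        rintro g ⟨a, ha⟩
        exact ⟨aᶜ, r_compl ha⟩
      bot_mem' := ⟨⊤ᶜ, by simpa using r_compl r_top⟩ }
  let S : MAlg :=
    { α := L
      f := fun g => ⟨(prodAlg A).f g.1, let ⟨b, hb⟩ := g.2; ⟨B.f b, r_f hb⟩⟩ }
  let h : S.α → B.α := fun g => Classical.choose g.2
  have hr : ∀ g : S.α, r (h g) g.1 := fun g => Classical.choose_spec g.2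
  refine ⟨S, ⟨prodAlg A, ⟨I, A, hA, id, ⟨fun _ _ => rfl, fun _ => rfl, rfl, fun _ => rfl⟩,
    Function.bijective_id⟩, Subtype.val, ⟨fun _ _ => rfl, fun _ => rfl, rfl, fun _ => rfl⟩,
    Subtype.val_injective⟩, h, ⟨fun g k => ?_, fun g => ?_, ?_, fun g => ?_⟩, fun b => ?_⟩
  · exact r_unique (hr _) (r_inf (hr g) (hr k))
  · exact r_unique (hr _) (r_compl (hr g))
  · exact r_unique (hr _) r_top
  · exact r_unique (hr _) (r_f (hr g))
  · have hb : r b (e b) := Filter.univ_mem' fun _ => rfl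
    exact ⟨⟨e b, b, hb⟩, r_unique (hr _) hb⟩

namespace StonePt

variable {A : MAlg}

/-- The elements of `Γ` that are necessary at a point. -/
def boxes (Γ : Set A.α) (x : StonePt A.α) : Set A.α := {a | a ∈ Γ ∧ A.f a ∈ x}

/-- The `Γ`-type of a point: the elements `a` and `A.f a`, for `a ∈ Γ`, that it contains. -/
def typ (Γ : Set A.α) (x : StonePt A.α) : Set A.α := {a | a ∈ Γ ∪ A.f '' Γ ∧ a ∈ x}

/-- The types of the successors of a point that have the same boxes. -/
def reach (Γ : Set A.α) (x : StonePt A.α) : Set (Set A.α) :=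
  typ Γ '' {z | Rel A x z ∧ boxes Γ z = boxes Γ x}

variable {Γ : Set A.α}

lemma finite_range_typ (hΓ : Γ.Finite) : (Set.range (typ Γ)).Finite :=
  (hΓ.union (hΓ.image A.f)).finite_subsets.subset
    (Set.range_subset_iff.2 fun _ _ ha => ha.1)

lemma boxes_congr {x y : StonePt A.α} (h : typ Γ x = typ Γ y) : boxes Γ x = boxes Γ y := by
  ext a
  have key := Set.ext_iff.1 h (A.f a)
  refine and_congr_right fun ha => ?_
  have hmem : A.f a ∈ Γ ∪ A.f '' Γ := Or.inr ⟨a, ha, rfl⟩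
  exact ⟨fun hx => (key.1 ⟨hmem, hx⟩).2, fun hy => (key.2 ⟨hmem, hy⟩).2⟩

lemma boxes_subset_of_rel {n : ℕ} (hA : A ∈ Vn n) {x y : StonePt A.α} (h : Rel A x y) :
    boxes Γ x ⊆ boxes Γ y :=
  fun _ ha => ⟨ha.1, h _ (f_le_f_f hA x ha.2)⟩

lemma exists_characteristic_typ (hΓ : Γ.Finite) (t : Set A.α) (ht : t ∈ Set.range (typ Γ)) :
    ∃ c : A.α, ∀ x : StonePt A.α, c ∈ x ↔ typ Γ x = t := by
  obtain ⟨y, rfl⟩ := ht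
  obtain ⟨c, hc⟩ := exists_characteristic (hΓ.union (hΓ.image A.f)) (typ Γ y)
  refine ⟨c, fun x => (hc x).trans ⟨fun h => ?_, fun h a ha => ?_⟩⟩
  · ext a
    exact ⟨fun ha => (h a ha.1).1 ha.2, fun ha => ⟨ha.1, (h a ha.1).2 ha⟩⟩
  · rw [← h]
    exact ⟨fun hx => ⟨ha, hx⟩, fun hx => hx.2⟩

/-- If all points above `x` with the same boxes reach the same types as `x`, then the scheme
`C_n` bounds the number of these types. -/
lemma ncard_reach_le {n : ℕ} (hA : A ∈ Vn n) (hΓ : Γ.Finite) {x : StonePt A.α}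
    (hx : ∀ z, Rel A x z → boxes Γ z = boxes Γ x → reach Γ z = reach Γ x) :
    (reach Γ x).ncard ≤ n := by
  by_contra! hlt
  have hfin : (reach Γ x).Finite := (finite_range_typ hΓ).subset (Set.image_subset_range _ _)
  have := hfin.to_subtype
  have hcard : Nat.card (Fin (n + 1)) ≤ Nat.card (reach Γ x) := by simpa using hlt
  obtain ⟨ι⟩ : Nonempty (Fin (n + 1) ↪ reach Γ x) := by
    have := Fintype.ofFinite (reach Γ x)
    exact Function.Embedding.nonempty_of_card_le (by simpa using hcard)
  let g : ℕ → Set A.α := fun i => ι (Fin.ofNat (n + 1) i)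
  have hg : ∀ i, g i ∈ reach Γ x := fun i => (ι _).2
  have hginj : ∀ i ≤ n, ∀ j ≤ n, g i = g j → i = j := fun i hi j hj h => by
    have := congrArg Fin.val (ι.injective (Subtype.ext h))
    simpa [Nat.mod_eq_of_lt (Nat.lt_succ_of_le hi), Nat.mod_eq_of_lt (Nat.lt_succ_of_le hj)]
      using this
  choose c hc using fun i =>
    exists_characteristic_typ hΓ (g i) (Set.image_subset_range _ _ (hg i))
  let V : ℕ → Set (StonePt A.α) := fun i => {y | c i ∈ y}
  have hsat : ∀ y i, sat (Rel A) V y (.var i) ↔ typ Γ y = g i := fun y i => hc i y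
  have hstep : ∀ z, Rel A x z → boxes Γ z = boxes Γ x → ∀ i, ∃ w, Rel A z w ∧
      boxes Γ w = boxes Γ x ∧ sat (Rel A) V w (.var i) := fun z hxz hz i => by
    have hi := hg i
    rw [← hx z hxz hz] at hi
    obtain ⟨w, ⟨hzw, hw⟩, hwi⟩ := hi
    exact ⟨w, hzw, hw.trans hz, (hsat w i).2 hwi⟩
  have hpath : ∀ (l : List ℕ) z, Rel A x z → boxes Γ z = boxes Γ x →
      sat (Rel A) V z (Pfml (.var 0) (l.map .var)) := by
    intro l
    induction l with
    | nil =>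
      intro z hxz hz
      obtain ⟨w, hw, -, hs⟩ := hstep z hxz hz 0
      exact sat_dia.2 ⟨w, hw, hs⟩
    | cons i l ih =>
      intro z hxz hz
      obtain ⟨w, hw, hb, hs⟩ := hstep z hxz hz i
      exact sat_dia.2 ⟨w, hw, hs, ih w (rel_transitive hA hxz hw) hb⟩
  have hD : ∀ y, sat (Rel A) V y (Dfml (.var 0 :: (List.range' 1 n).map .var)) := fun y => by
    have hrange : (Fml.var 0 :: (List.range' 1 n).map .var) =
        (List.range' 0 (n + 1)).map .var := by simp [List.range'_succ]
    rw [hrange, sat_Dfml, List.pairwise_map]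
    refine List.Pairwise.imp_of_mem ?_ (List.nodup_range' (step := 1))
    intro i j hi hj hij ⟨h1, h2⟩
    rw [hsat] at h1 h2
    simp only [List.mem_range'_1] at hi hj
    exact hij (hginj i (by omega) j (by omega) (h1.symm.trans h2))
  have hC := sat_Cfml.1 (sat_of_mem_Vn hA
    (Prov.ax (Or.inr ⟨.var 0, (List.range' 1 n).map .var, by simp, rfl⟩)) c x)
  obtain ⟨z, hxz, hz, hP⟩ := hC ⟨hD x, fun y _ => hD y⟩ (by
    obtain ⟨w, ⟨hw, -⟩, h⟩ := hg 0
    exact ⟨w, hw, (hsat w 0).2 h⟩)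
  refine hP (hpath _ z hxz ?_)
  obtain ⟨w, ⟨-, hb⟩, hw⟩ := hg 0
  rw [← hb]
  exact boxes_congr (((hsat z 0).1 hz).trans hw.symm)

/-- For each set of boxes there is a set of at most `n` types with these boxes that suffices to
refute everything else in `Γ`, together with the points having strictly more boxes. -/
lemma exists_nucleus {n : ℕ} (hA : A ∈ Vn n) (hΓ : Γ.Finite) (b : Set A.α) :
    ∃ S : Set (Set A.α), S.Finite ∧ S.ncard ≤ n ∧
      ∀ x : StonePt A.α, boxes Γ x = b → ∀ a ∈ Γ, A.f a ∉ x →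
        ∃ y : StonePt A.α, a ∉ y ∧ b ⊆ {c | c ∈ y} ∧ b ⊆ boxes Γ y ∧
          (boxes Γ y = b → typ Γ y ∈ S) := by
  have hfin : ∀ y, (reach Γ y).Finite := fun y =>
    (finite_range_typ hΓ).subset (Set.image_subset_range _ _)
  rcases Set.eq_empty_or_nonempty {x : StonePt A.α | boxes Γ x = b} with h | h
  · exact ⟨∅, Set.finite_empty, by simp, fun x hx => (Set.eq_empty_iff_forall_notMem.1 h x hx).elim⟩
  obtain ⟨y, rfl, hmin⟩ := (measure fun y => (reach Γ y).ncard).wf.has_min _ h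
  refine ⟨reach Γ y, hfin y, ncard_reach_le hA hΓ fun z hyz hz => ?_, fun x hx a ha hfa => ?_⟩
  · refine Set.eq_of_subset_of_ncard_le ?_ (not_lt.1 (hmin z hz)) (hfin y)
    rintro _ ⟨w, ⟨hzw, hw⟩, rfl⟩
    exact ⟨w, ⟨rel_transitive hA hyz hzw, hw.trans hz⟩, rfl⟩
  · have hfy : A.f a ∉ y := fun h => hfa (hx.symm.subset (show a ∈ boxes Γ y from ⟨ha, h⟩)).2
    rw [forall_rel_mem_iff hA.1] at hfy
    push Not at hfy
    obtain ⟨z, hyz, hz⟩ := hfy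
    exact ⟨z, hz, fun c hc => hyz c hc.2, boxes_subset_of_rel hA hyz, fun h => ⟨z, ⟨hyz, h⟩, rfl⟩⟩

/-- Filtration through a finite set `Γ`, with the relation pruned inside each cluster. -/
lemma exists_filtration {n : ℕ} (hA : A ∈ Vn n) (hΓ : Γ.Finite) :
    ∃ (W : Type) (R : W → W → Prop) (π : StonePt A.α → W), Finite W ∧ Transitive R ∧
      CircumLE R n ∧ Function.Surjective π ∧
      (∀ x y, π x = π y → ∀ a ∈ Γ ∪ A.f '' Γ, (a ∈ x ↔ a ∈ y)) ∧
      ∀ x, ∀ a ∈ Γ, (A.f a ∈ x ↔ ∀ y, R (π x) (π y) → a ∈ y) := by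
  choose S hSfin hScard hS using exists_nucleus hA hΓ
  let bx : Set A.α → Set A.α := fun t => {a | a ∈ Γ ∧ A.f a ∈ t}
  have hbx : ∀ x, bx (typ Γ x) = boxes Γ x := fun x => by
    ext a
    exact and_congr_right fun ha => and_iff_right (Or.inr ⟨a, ha, rfl⟩)
  let R : Set.range (typ Γ) → Set.range (typ Γ) → Prop := fun s t =>
    bx s ⊆ t ∧ bx s ⊆ bx t ∧ (bx t = bx s → t.1 ∈ S (bx s))
  have hR : Transitive R := by
    rintro s t u ⟨-, hst, -⟩ ⟨htu, htu', htu''⟩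
    refine ⟨hst.trans htu, hst.trans htu', fun h => ?_⟩
    have hts : bx t = bx s := (htu'.trans h.subset).antisymm hst
    rw [← hts]
    exact htu'' (h.trans hts.symm)
  refine ⟨Set.range (typ Γ), R, Set.rangeFactorization (typ Γ),
    (finite_range_typ hΓ).to_subtype, hR, ?_, Set.rangeFactorization_surjective, ?_, ?_⟩
  · rintro k ⟨hk, x, hinj, hcyc⟩
    have hall := fun i hi j hj => hR.rel_of_cycle hcyc (i := i) (j := j) hi hj
    have hmem : ∀ j < k, (x j).1 ∈ S (bx (x 0)) := fun j hj =>
      (hall 0 hk j hj).2.2 ((hall j hj 0 hk).2.1.antisymm (hall 0 hk j hj).2.1)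
    have hle := Finset.card_le_card_of_injOn (s := Finset.range k)
      (t := (hSfin (bx (x 0))).toFinset) (fun i => (x i).1)
      (fun i hi => by simpa using hmem i (by simpa using hi))
      (fun i hi j hj h => hinj i j (by simpa using hi) (by simpa using hj) (Subtype.ext h))
    rw [Finset.card_range, ← Set.ncard_eq_toFinset_card _ (hSfin _)] at hle
    exact hle.trans (hScard _)
  · intro x y hxy a ha
    have := Set.ext_iff.1 (congrArg Subtype.val hxy) a
    exact ⟨fun h => (this.1 ⟨ha, h⟩).2, fun h => (this.2 ⟨ha, h⟩).2⟩
  · intro x a ha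
    have hval : ∀ x, bx (Set.rangeFactorization (typ Γ) x) = boxes Γ x := hbx
    refine ⟨fun h y hxy => ?_, fun h => ?_⟩
    · exact (hxy.1 ((hval x).symm.subset (show a ∈ boxes Γ x from ⟨ha, h⟩))).2
    · by_contra hfa
      obtain ⟨y, hy, h1, h2, h3⟩ := hS (boxes Γ x) x rfl a ha hfa
      refine hy (h y ⟨?_, ?_, ?_⟩) <;> simp only [hval]
      · exact fun c hc => ⟨Or.inl hc.1, h1 hc⟩
      · exact h2
      · exact h3

end StonePt

/-- Every finite piece of an algebra in `V_n` is represented in a member of `CnPlus n`. -/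
lemma exists_partial_embedding {n : ℕ} {A : MAlg} (hA : A ∈ Vn n) {Γ : Set A.α} (hΓ : Γ.Finite) :
    ∃ B ∈ CnPlus n, ∃ e : A.α → B.α,
      (∀ a ∈ Γ, ∀ b ∈ Γ, e a = e b → a = b) ∧
      (∀ a ∈ Γ, ∀ b ∈ Γ, a ⊓ b ∈ Γ → e (a ⊓ b) = e a ⊓ e b) ∧
      (∀ a ∈ Γ, aᶜ ∈ Γ → e aᶜ = (e a)ᶜ) ∧ (⊤ ∈ Γ → e ⊤ = ⊤) ∧
      ∀ a ∈ Γ, e (A.f a) = B.f (e a) := by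
  obtain ⟨W, R, π, hW, hR, hn, hπ, hmem, hbox⟩ := StonePt.exists_filtration hA hΓ
  let e : A.α → Set W := fun a => {w | ∃ x, π x = w ∧ a ∈ x}
  have he : ∀ a ∈ Γ ∪ A.f '' Γ, ∀ x, π x ∈ e a ↔ a ∈ x := fun a ha x =>
    ⟨fun ⟨y, hyx, hy⟩ => (hmem y x hyx a ha).1 hy, fun h => ⟨x, rfl, h⟩⟩
  have ext : ∀ s t : Set W, (∀ x, π x ∈ s ↔ π x ∈ t) → s = t := fun s t h =>
    Set.ext (hπ.forall.2 h)
  refine ⟨cplx W R, ⟨W, R, hW, hR, hn, rfl⟩, e, fun a ha b hb h => ?_,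
    fun a ha b hb hab => ext _ _ fun x => ?_, fun a ha hac => ext _ _ fun x => ?_,
    fun h => ext _ _ fun x => ?_, fun a ha => ext _ _ fun x => ?_⟩
  · refine StonePt.eq_of_forall_mem_iff fun x => ?_
    rw [← he a (.inl ha), ← he b (.inl hb), h]
  · rw [he _ (.inl hab), x.mem_inf, ← he a (.inl ha), ← he b (.inl hb)]
    rfl
  · rw [he _ (.inl hac), x.mem_compl, ← he a (.inl ha)]
    rfl
  · rw [he _ (.inl h)]
    exact iff_of_true x.mem_top trivial
  · rw [he _ (.inr ⟨a, ha, rfl⟩), hbox x a ha]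
    refine Iff.trans ?_ hπ.forall.symm
    exact forall_congr' fun y => imp_congr_right fun _ => (he a (.inl ha) y).symm

lemma Vn_subset_SPuCl (n : ℕ) : Vn n ⊆ SPuCl (CnPlus n) := by
  intro A hA
  choose B hB e hinj hinf hcompl htop hf using fun Γ : Finset A.α =>
    exists_partial_embedding hA Γ.finite_toSet
  let U : Ultrafilter (Finset A.α) := Ultrafilter.of Filter.atTop
  have hev : ∀ a : A.α, ∀ᶠ Γ in (U : Filter (Finset A.α)), a ∈ Γ := by
    classical
    intro a
    filter_upwards [Ultrafilter.of_le _ (Filter.eventually_ge_atTop {a})] with Γ h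
    simpa using h
  refine ⟨Finset A.α, U, B, hB, fun a Γ => e Γ a, fun a b h => ?_,
    fun a b => ?_, fun a => ?_, ?_, fun a => ?_⟩
  · obtain ⟨Γ, h, ha, hb⟩ := (Filter.Eventually.and h ((hev a).and (hev b))).exists
    exact hinj Γ a ha b hb h
  · filter_upwards [hev a, hev b, hev (a ⊓ b)] with Γ h1 h2 h3 using hinf Γ a h1 b h2 h3
  · filter_upwards [hev a, hev aᶜ] with Γ h1 h2 using hcompl Γ a h1 h2
  · filter_upwards [hev ⊤] with Γ h1 using htop Γ h1
  · filter_upwards [hev a] with Γ h1 using hf Γ a h1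

/-- V_n = HSP(𝒞_n⁺) = SP_U(𝒞_n⁺); in particular every member of V_n
embeds into an ultraproduct of complex algebras of finite transitive frames of
circumference at most n. -/
theorem stmt19 (n : ℕ) :
    Vn n = Hcl (Scl (Pcl (CnPlus n))) ∧ Vn n = SPuCl (CnPlus n) := by
  have hHSP : Hcl (Scl (Pcl (CnPlus n))) ⊆ Vn n :=
    Hcl_subset_Vn (Scl_subset_Vn (Pcl_subset_Vn (CnPlus_subset_Vn n)))
  have hSPu := SPuCl_subset_HSP (CnPlus n)
  exact ⟨((Vn_subset_SPuCl n).trans hSPu).antisymm hHSP,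
    (Vn_subset_SPuCl n).antisymm (hSPu.trans hHSP)⟩
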